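/- Let λ₁, λ₂ be nonzero real constants with λ₁/λ₂ rational, say λ₁/λ₂ = p/q with p, q integers, q ≠ 0. Then the complex vector space of smooth ℤ²-periodic functions f : ℝ² → ℂ satisfying λ₂ ∂f/∂x₁ + λ₁ ∂f/∂x₂ = 0 is infinite-dimensional: the family of functions f_s(x₁,x₂) = exp(2πi s (p x₁ − q x₂)), s ∈ ℤ, consists of solutions and is linearly independent. (For the trivial Spin structure on the flat left-invariant Lorentzian torus with rational ratio λ₁/λ₂, δ₊ = +∞.) -/

import Mathlib

noncomputable section

/-- The character `x ↦ exp (2πi s (p x₁ - q x₂))` of the additive group `ℝ × ℝ`. -/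
def torusCharacter (p q s : ℤ) : Multiplicative (ℝ × ℝ) →* ℂ where
  toFun x := Complex.exp (2 * Real.pi * Complex.I * (s : ℂ) *
    ((p : ℂ) * (x.toAdd.1 : ℂ) - (q : ℂ) * (x.toAdd.2 : ℂ)))
  map_one' := by simp
  map_mul' x y := by
    rw [← Complex.exp_add]
    congr 1
    simp only [toAdd_mul, Prod.fst_add, Prod.snd_add, Complex.ofReal_add]
    ring

theorem torusCharacter_injective (p : ℤ) {q : ℤ} (hq : q ≠ 0) :
    Function.Injective (torusCharacter p q) := by
  intro s t hst
  by_contra hne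
  have hqC : (q : ℂ) ≠ 0 := Int.cast_ne_zero.mpr hq
  have hsub : (s : ℂ) - t ≠ 0 := sub_ne_zero.mpr (Int.cast_injective.ne hne)
  have heval := DFunLike.congr_fun hst
    (Multiplicative.ofAdd ((0 : ℝ), 1 / (2 * (q : ℝ) * ((s : ℝ) - t))))
  simp only [torusCharacter, MonoidHom.coe_mk, OneHom.coe_mk, toAdd_ofAdd] at heval
  -- The quotient of the two values at this point is `exp (πi) = -1`.
  have hquot := div_eq_one_iff_eq (Complex.exp_ne_zero _) |>.mpr heval.symm
  rw [← Complex.exp_sub] at hquot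
  have hexp : 2 * Real.pi * Complex.I * (t : ℂ) * ((p : ℂ) * ((0 : ℝ) : ℂ) -
        (q : ℂ) * ((1 / (2 * (q : ℝ) * ((s : ℝ) - t)) : ℝ) : ℂ)) -
      2 * Real.pi * Complex.I * (s : ℂ) * ((p : ℂ) * ((0 : ℝ) : ℂ) -
        (q : ℂ) * ((1 / (2 * (q : ℝ) * ((s : ℝ) - t)) : ℝ) : ℂ)) =
      Real.pi * Complex.I := by
    push_cast
    field_simp
    ring
  rw [hexp, Complex.exp_pi_mul_I] at hquot
  norm_num at hquot

theorem hasDerivAt_cexp_mul_ofReal_add (a b : ℂ) (t : ℝ) :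
    HasDerivAt (fun u : ℝ => Complex.exp (a * u + b)) (Complex.exp (a * t + b) * a) t := by
  simpa using (((Complex.ofRealCLM.hasDerivAt (x := t)).const_mul a).add_const b).cexp

theorem infinite_dim_harmonic_spinors_flat_rational
    (lam₁ lam₂ : ℝ) (hlam₁ : lam₁ ≠ 0) (hlam₂ : lam₂ ≠ 0)
    (p q : ℤ) (hq : q ≠ 0) (hpq : lam₁ / lam₂ = (p : ℝ) / (q : ℝ)) :
    (∀ s : ℤ,
      ContDiff ℝ (⊤ : ℕ∞) (fun x : ℝ × ℝ =>
        Complex.exp (2 * Real.pi * Complex.I * (s : ℂ) *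
          ((p : ℂ) * (x.1 : ℂ) - (q : ℂ) * (x.2 : ℂ)))) ∧
      (∀ (x : ℝ × ℝ) (z : ℤ × ℤ),
        Complex.exp (2 * Real.pi * Complex.I * (s : ℂ) *
            ((p : ℂ) * ((x.1 + z.1 : ℝ) : ℂ) - (q : ℂ) * ((x.2 + z.2 : ℝ) : ℂ))) =
          Complex.exp (2 * Real.pi * Complex.I * (s : ℂ) *
            ((p : ℂ) * (x.1 : ℂ) - (q : ℂ) * (x.2 : ℂ)))) ∧
      (∀ x : ℝ × ℝ,
        (lam₂ : ℂ) * deriv (fun s' : ℝ =>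
            Complex.exp (2 * Real.pi * Complex.I * (s : ℂ) *
              ((p : ℂ) * (s' : ℂ) - (q : ℂ) * (x.2 : ℂ)))) x.1 +
          (lam₁ : ℂ) * deriv (fun t' : ℝ =>
            Complex.exp (2 * Real.pi * Complex.I * (s : ℂ) *
              ((p : ℂ) * (x.1 : ℂ) - (q : ℂ) * (t' : ℂ)))) x.2 = 0)) ∧
    LinearIndependent ℂ (fun (s : ℤ) (x : ℝ × ℝ) =>
      Complex.exp (2 * Real.pi * Complex.I * (s : ℂ) *
        ((p : ℂ) * (x.1 : ℂ) - (q : ℂ) * (x.2 : ℂ)))) := by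
  refine ⟨fun s => ⟨?_, fun x z => ?_, fun x => ?_⟩, ?_⟩
  · have hfst : ContDiff ℝ (⊤ : ℕ∞) (fun x : ℝ × ℝ => (x.1 : ℂ)) :=
      Complex.ofRealCLM.contDiff.comp contDiff_fst
    have hsnd : ContDiff ℝ (⊤ : ℕ∞) (fun x : ℝ × ℝ => (x.2 : ℂ)) :=
      Complex.ofRealCLM.contDiff.comp contDiff_snd
    exact (contDiff_const.mul
      ((contDiff_const.mul hfst).sub (contDiff_const.mul hsnd))).cexp
  · rw [Complex.exp_eq_exp_iff_exists_int]
    refine ⟨s * (p * z.1 - q * z.2), ?_⟩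
    push_cast
    ring
  · have hratio : (lam₁ : ℂ) * q = p * lam₂ := by
      rw [div_eq_div_iff hlam₂ (Int.cast_ne_zero.mpr hq)] at hpq
      exact_mod_cast hpq
    have hderiv₁ := hasDerivAt_cexp_mul_ofReal_add (2 * Real.pi * Complex.I * s * p)
      (-(2 * Real.pi * Complex.I * s * (q * x.2))) x.1
    have hderiv₂ := hasDerivAt_cexp_mul_ofReal_add (-(2 * Real.pi * Complex.I * s * q))
      (2 * Real.pi * Complex.I * s * (p * x.1)) x.2
    have hphase₁ (u : ℝ) : 2 * Real.pi * Complex.I * s * p * u +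
        -(2 * Real.pi * Complex.I * s * (q * x.2)) =
        2 * Real.pi * Complex.I * s * (p * u - q * x.2) := by ring
    have hphase₂ (u : ℝ) : -(2 * Real.pi * Complex.I * s * q) * u +
        2 * Real.pi * Complex.I * s * (p * x.1) =
        2 * Real.pi * Complex.I * s * (p * x.1 - q * u) := by ring
    simp only [hphase₁] at hderiv₁
    simp only [hphase₂] at hderiv₂
    rw [hderiv₁.deriv, hderiv₂.deriv]
    linear_combination (-(2 * Real.pi * Complex.I * s) *
      Complex.exp (2 * Real.pi * Complex.I * s * (p * x.1 - q * x.2))) * hratio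
  · exact (linearIndependent_monoidHom (Multiplicative (ℝ × ℝ)) ℂ).comp
      (torusCharacter p q) (torusCharacter_injective p hq)
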